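/- Let X : ℝ² × ℝ → ℝ² be a continuously differentiable time-dependent vector field with div_z X(z,t) = 0 for all (z,t), and let φ : ℝ² × ℝ → ℝ² be continuously differentiable with φ(z,0) = z and ∂_t φ(z,t) = X(φ(z,t),t) for all (z,t), such that for each t the map φ_t := φ(·,t) : ℝ² → ℝ² is a bijection. Then for each t the map φ_t preserves Lebesgue measure on ℝ²: the pushforward of Lebesgue measure under φ_t equals Lebesgue measure. -/

import Mathlib

open MeasureTheory
open scoped ENNReal RealInnerProductSpace

noncomputable section

/-- The Euclidean plane. -/
abbrev E2 := EuclideanSpace ℝ (Fin 2)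

/-- Divergence of a planar vector field: `div Y = ∂₁Y₁ + ∂₂Y₂`. -/
def div2 (Y : E2 → E2) (z : E2) : ℝ :=
  fderiv ℝ Y z (EuclideanSpace.single 0 1) 0 + fderiv ℝ Y z (EuclideanSpace.single 1 1) 1

/-- Scalar curl of a planar vector field: `curl Y = ∂₁Y₂ − ∂₂Y₁`. -/
def curl2 (Y : E2 → E2) (z : E2) : ℝ :=
  fderiv ℝ Y z (EuclideanSpace.single 0 1) 1 - fderiv ℝ Y z (EuclideanSpace.single 1 1) 0

/-- The rotation `J(a, b) = (b, −a)`. -/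
def J2 (v : E2) : E2 := (WithLp.equiv 2 (Fin 2 → ℝ)).symm ![v 1, -v 0]

/-- Differentiation under the integral sign for a `C¹` integrand on a compact interval. -/
theorem hasFDerivAt_intervalIntegral_of_contDiff {H E : Type*}
    [NormedAddCommGroup H] [NormedSpace ℝ H] [ProperSpace H]
    [NormedAddCommGroup E] [NormedSpace ℝ E]
    {G : H × ℝ → E} (hG : ContDiff ℝ 1 G) (a b : ℝ) (x₀ : H) :
    HasFDerivAt (fun x => ∫ s in a..b, G (x, s))
      (∫ s in a..b, (fderiv ℝ G (x₀, s)).comp (ContinuousLinearMap.inl ℝ H ℝ)) x₀ := by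
  have hcont : Continuous fun p : H × ℝ =>
      (fderiv ℝ G p).comp (ContinuousLinearMap.inl ℝ H ℝ) :=
    (hG.continuous_fderiv one_ne_zero).clm_comp continuous_const
  obtain ⟨C, hC⟩ := ((isCompact_closedBall x₀ 1).prod
    (isCompact_uIcc (a := a) (b := b))).exists_bound_of_continuousOn hcont.continuousOn
  have hslice : ∀ x, Continuous fun s => G (x, s) := fun x =>
    hG.continuous.comp (Continuous.prodMk_right x)
  refine intervalIntegral.hasFDerivAt_integral_of_dominated_of_fderiv_le
    (F' := fun x s => (fderiv ℝ G (x, s)).comp (ContinuousLinearMap.inl ℝ H ℝ))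
    (bound := fun _ => C) (Metric.closedBall_mem_nhds x₀ one_pos)
    (Filter.Eventually.of_forall fun x => (hslice x).aestronglyMeasurable)
    ((hslice x₀).intervalIntegrable a b)
    (hcont.comp (Continuous.prodMk_right x₀)).aestronglyMeasurable
    (Filter.Eventually.of_forall fun s hs x hx => hC (x, s) ⟨hx, Set.uIoc_subset_uIcc hs⟩)
    intervalIntegrable_const
    (Filter.Eventually.of_forall fun s _ x _ => ?_)
  exact ((hG.differentiable one_ne_zero (x, s)).hasFDerivAt).comp x (hasFDerivAt_prodMk_left x s)

/-- The variational equation: the spatial derivative of the flow of a `C¹` time-dependent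
vector field solves the linearized equation. -/
theorem hasDerivAt_fderiv_flow {E : Type*} [NormedAddCommGroup E] [NormedSpace ℝ E]
    [FiniteDimensional ℝ E] {X φ : E × ℝ → E} (hX : ContDiff ℝ 1 X) (hφ : ContDiff ℝ 1 φ)
    (hφ0 : ∀ z, φ (z, 0) = z)
    (hflow : ∀ z t, HasDerivAt (fun τ => φ (z, τ)) (X (φ (z, t), t)) t) (z : E) (t : ℝ) :
    HasDerivAt (fun τ => fderiv ℝ (fun w => φ (w, τ)) z)
      ((fderiv ℝ (fun w => X (w, t)) (φ (z, t))).comp (fderiv ℝ (fun w => φ (w, t)) z)) t := by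
  have : ProperSpace E := FiniteDimensional.proper ℝ E
  have hG : ContDiff ℝ 1 fun p : E × ℝ => X (φ p, p.2) := hX.comp (hφ.prodMk contDiff_snd)
  set G : E × ℝ → E := fun p => X (φ p, p.2)
  set D : ℝ → E →L[ℝ] E := fun s =>
    (fderiv ℝ G (z, s)).comp (ContinuousLinearMap.inl ℝ E ℝ)
  have hDcont : Continuous D :=
    ((hG.continuous_fderiv one_ne_zero).comp (Continuous.prodMk_right z)).clm_comp
      continuous_const
  have hint : ∀ w τ, φ (w, τ) = w + ∫ s in (0 : ℝ)..τ, G (w, s) := fun w τ => by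
    rw [intervalIntegral.integral_eq_sub_of_hasDerivAt (fun s _ => hflow w s)
      ((hG.continuous.comp (Continuous.prodMk_right w)).intervalIntegrable _ _), hφ0]
    abel
  have hM : ∀ τ, fderiv ℝ (fun w => φ (w, τ)) z =
      ContinuousLinearMap.id ℝ E + ∫ s in (0 : ℝ)..τ, D s := fun τ => by
    simp_rw [hint]
    exact ((hasFDerivAt_id z).add (hasFDerivAt_intervalIntegral_of_contDiff hG 0 τ z)).fderiv
  have hDt : D t = (fderiv ℝ (fun w => X (w, t)) (φ (z, t))).comp
      (fderiv ℝ (fun w => φ (w, t)) z) := by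
    have hslice : HasFDerivAt (fun w => G (w, t)) (D t) z :=
      HasFDerivAt.comp (g := G) z (hG.differentiable one_ne_zero (z, t)).hasFDerivAt
        (hasFDerivAt_prodMk_left z t)
    have hXt : Differentiable ℝ fun w => X (w, t) :=
      (hX.comp (contDiff_id.prodMk contDiff_const)).differentiable one_ne_zero
    have hφt : Differentiable ℝ fun w => φ (w, t) :=
      (hφ.comp (contDiff_id.prodMk contDiff_const)).differentiable one_ne_zero
    exact hslice.unique (HasFDerivAt.comp (g := fun w => X (w, t)) z
      (hXt (φ (z, t))).hasFDerivAt (hφt z).hasFDerivAt)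
  simp_rw [← hDt, hM]
  exact (intervalIntegral.integral_hasDerivAt_right (hDcont.intervalIntegrable _ _)
    (hDcont.stronglyMeasurableAtFilter _ _) hDcont.continuousAt).const_add _

/-- The determinant of a planar linear map in terms of its matrix entries. -/
theorem det_clm_E2 (L : E2 →L[ℝ] E2) :
    L.det = L (EuclideanSpace.single 0 1) 0 * L (EuclideanSpace.single 1 1) 1 -
      L (EuclideanSpace.single 1 1) 0 * L (EuclideanSpace.single 0 1) 1 := by
  rw [ContinuousLinearMap.det,
    ← LinearMap.det_toMatrix (EuclideanSpace.basisFun (Fin 2) ℝ).toBasis, Matrix.det_fin_two]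
  simp [LinearMap.toMatrix_apply]

/-- Coordinates of a planar linear map applied to a vector. -/
theorem clm_E2_apply (L : E2 →L[ℝ] E2) (v : E2) (i : Fin 2) :
    L v i = v 0 * L (EuclideanSpace.single 0 1) i + v 1 * L (EuclideanSpace.single 1 1) i := by
  have hv : v = v 0 • EuclideanSpace.single 0 (1 : ℝ) + v 1 • EuclideanSpace.single 1 (1 : ℝ) := by
    ext j
    fin_cases j <;> simp
  conv_lhs => rw [hv]
  simp

/-- A planar linear matrix equation with trace-free coefficient preserves the determinant. -/
theorem hasDerivAt_det_of_trace_eq_zero {M : ℝ → E2 →L[ℝ] E2} {A : E2 →L[ℝ] E2} {t : ℝ}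
    (hM : HasDerivAt M (A.comp (M t)) t)
    (hA : A (EuclideanSpace.single 0 1) 0 + A (EuclideanSpace.single 1 1) 1 = 0) :
    HasDerivAt (fun τ => (M τ).det) 0 t := by
  have hentry : ∀ (v : E2) (i : Fin 2), HasDerivAt (fun τ => M τ v i) (A (M t v) i) t :=
    fun v i => (EuclideanSpace.proj (𝕜 := ℝ) i).hasFDerivAt.comp_hasDerivAt t
      ((ContinuousLinearMap.apply ℝ E2 v).hasFDerivAt.comp_hasDerivAt t hM)
  simp_rw [det_clm_E2]
  refine (((hentry (EuclideanSpace.single 0 1) 0).mul (hentry (EuclideanSpace.single 1 1) 1)).sub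
    ((hentry (EuclideanSpace.single 1 1) 0).mul
      (hentry (EuclideanSpace.single 0 1) 1))).congr_deriv ?_
  simp only [clm_E2_apply A (M t _)]
  rw [eq_neg_of_add_eq_zero_left hA]
  ring

/-- Liouville's theorem in the plane: the flow maps of a divergence-free `C¹`
time-dependent vector field preserve Lebesgue measure. -/
theorem stmt_9 (X : E2 × ℝ → E2) (φ : E2 × ℝ → E2)
    (hX : ContDiff ℝ 1 X) (hφ : ContDiff ℝ 1 φ)
    (hdiv : ∀ z t, div2 (fun w => X (w, t)) z = 0)
    (hφ0 : ∀ z, φ (z, 0) = z)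
    (hflow : ∀ z t, HasDerivAt (fun τ => φ (z, τ)) (X (φ (z, t), t)) t)
    (hbij : ∀ t, Function.Bijective fun z => φ (z, t)) :
    ∀ t, Measure.map (fun z => φ (z, t)) volume = volume := by
  intro t
  have hdet : ∀ z, (fderiv ℝ (fun w => φ (w, t)) z).det = 1 := fun z => by
    have hderiv : ∀ τ, HasDerivAt (fun τ => (fderiv ℝ (fun w => φ (w, τ)) z).det) 0 τ :=
      fun τ => hasDerivAt_det_of_trace_eq_zero
        (hasDerivAt_fderiv_flow hX hφ hφ0 hflow z τ) (hdiv (φ (z, τ)) τ)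
    rw [is_const_of_deriv_eq_zero (fun τ => (hderiv τ).differentiableAt)
      (fun τ => (hderiv τ).deriv) t 0]
    simp_rw [hφ0]
    simp [det_clm_E2]
  have hφt : Differentiable ℝ fun w => φ (w, t) :=
    (hφ.comp (contDiff_id.prodMk contDiff_const)).differentiable one_ne_zero
  have hmap := map_withDensity_abs_det_fderiv_eq_addHaar (volume : Measure E2)
    MeasurableSet.univ.nullMeasurableSet
    (fun z _ => (hφt z).hasFDerivAt.hasFDerivWithinAt) (hbij t).injective.injOn
  simpa [hdet, (hbij t).surjective.range_eq] using hmap
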